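/- There exists an infinite, locally finite, connected graph that admits no rooted tree-decomposition into finite parts which is simultaneously strongly linked, tight and componental. -/

import Mathlib

open SimpleGraph

universe u v

section CommonDefs

variable {V : Type u} {N : Type v}

/-- `u` and `w` are joined by a walk in `G` all of whose vertices avoid `X`,
i.e. they lie in the same component of `G - X`. -/
def ConnAvoiding (G : SimpleGraph V) (X : Set V) (u w : V) : Prop :=
  ∃ p : G.Walk u w, ∀ x ∈ p.support, x ∉ X

/-- `r` is a (one-way infinite) ray in `G`. -/
def IsRay (G : SimpleGraph V) (r : ℕ → V) : Prop :=
  Function.Injective r ∧ ∀ n : ℕ, G.Adj (r n) (r (n + 1))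

/-- Two rays are equivalent (i.e. belong to the same end) if for every finite vertex set `X`
they have tails in the same component of `G - X`. -/
def RayEquiv (G : SimpleGraph V) (r r' : ℕ → V) : Prop :=
  ∀ X : Set V, X.Finite → ∃ M : ℕ, ∀ m ≥ M, ∀ n ≥ M, ConnAvoiding G X (r m) (r' n)

/-- `v` lies in the component `C_G(X, ε)` of `G - X` containing a tail of the ray `r`. -/
def InEndComp (G : SimpleGraph V) (X : Set V) (r : ℕ → V) (v : V) : Prop :=
  ∃ M : ℕ, ∀ n ≥ M, ConnAvoiding G X v (r n)

/-- `v` dominates the end of the ray `r`. -/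
def Dominates (G : SimpleGraph V) (r : ℕ → V) (v : V) : Prop :=
  ∀ X : Set V, X.Finite → v ∉ X → InEndComp G X r v

/-- `Dom(ε)` for the end `ε` of the ray `r`. -/
def DomSet (G : SimpleGraph V) (r : ℕ → V) : Set V := {v | Dominates G r v}

/-- There are `n` pairwise (vertex-)disjoint rays belonging to the end of `r`. -/
def HasDisjRays (G : SimpleGraph V) (r : ℕ → V) (n : ℕ) : Prop :=
  ∃ f : Fin n → ℕ → V, (∀ i, IsRay G (f i)) ∧ (∀ i, RayEquiv G r (f i)) ∧
    Pairwise fun i j => ∀ k l : ℕ, f i k ≠ f j l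

/-- The degree of the end of `r`, as an extended natural number. -/
noncomputable def EndDegree (G : SimpleGraph V) (r : ℕ → V) : ℕ∞ :=
  ⨆ (n : ℕ) (_ : HasDisjRays G r n), (n : ℕ∞)

/-- A family of pairwise disjoint `A`–`B` paths indexed by `ι`. -/
def DisjointPathsFam (G : SimpleGraph V) (A B : Set V) (ι : Type*) : Prop :=
  ∃ (a b : ι → V) (p : ∀ i : ι, G.Walk (a i) (b i)),
    (∀ i, (p i).IsPath) ∧ (∀ i, a i ∈ A) ∧ (∀ i, b i ∈ B) ∧
    Pairwise fun i j => ∀ x ∈ (p i).support, x ∉ (p j).support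

/-- There are `n` pairwise disjoint `A`–`B` paths in `G`. -/
def DisjointPaths (G : SimpleGraph V) (A B : Set V) (n : ℕ) : Prop :=
  DisjointPathsFam G A B (Fin n)

/-- `C` is (the vertex set of) a connected component of the subgraph of `G` induced on `S`. -/
def IsCompOf (G : SimpleGraph V) (S C : Set V) : Prop :=
  C.Nonempty ∧ C ⊆ S ∧ (G.induce C).Connected ∧
    ∀ u ∈ C, ∀ v ∈ S, G.Adj u v → v ∈ C

/-- The neighbourhood `N_G(C)` of the set `C` in `G`. -/
def NbhdSet (G : SimpleGraph V) (C : Set V) : Set V :=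
  {v | v ∉ C ∧ ∃ u ∈ C, G.Adj u v}

/-- A graph is locally finite if every vertex has finite degree. -/
def LocFin (G : SimpleGraph V) : Prop := ∀ v : V, {w : V | G.Adj v w}.Finite

/-- A tree-decomposition of `G` with decomposition tree `T`. -/
structure TreeDecomp (G : SimpleGraph V) (T : SimpleGraph N) : Type (max u v) where
  isTree : T.IsTree
  bag : N → Set V
  bag_cover : ∀ v : V, ∃ t : N, v ∈ bag t
  bag_edge : ∀ ⦃x y : V⦄, G.Adj x y → ∃ t : N, x ∈ bag t ∧ y ∈ bag t
  bag_conn : ∀ (v : V) {s t : N} (p : T.Walk s t), p.IsPath →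
    v ∈ bag s → v ∈ bag t → ∀ x ∈ p.support, v ∈ bag x

namespace TreeDecomp

variable {G : SimpleGraph V} {T : SimpleGraph N}

/-- The unique path in the tree `T` from `s` to `t`. -/
noncomputable def path (D : TreeDecomp G T) (s t : N) : T.Walk s t :=
  (D.isTree.existsUnique_path s t).choose

/-- The adhesion set of the edge `ab` of `T`. -/
def adh (D : TreeDecomp G T) (a b : N) : Set V := D.bag a ∩ D.bag b

/-- `ab` is an edge of `T` lying on the path from `s` to `t`. -/
def EdgeOnPath (D : TreeDecomp G T) (s t a b : N) : Prop :=
  T.Adj a b ∧ s(a, b) ∈ (D.path s t).edges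

/-- All bags are finite. -/
def FiniteParts (D : TreeDecomp G T) : Prop := ∀ t : N, (D.bag t).Finite

/-- The tree-decomposition is lean. -/
def IsLean (D : TreeDecomp G T) : Prop :=
  ∀ (s t : N) (Zs Zt : Finset V), ↑Zs ⊆ D.bag s → ↑Zt ⊆ D.bag t →
    Zs.card = Zt.card →
    DisjointPaths G ↑Zs ↑Zt Zs.card ∨
      ∃ a b : N, D.EdgeOnPath s t a b ∧ (D.adh a b).encard < (Zs.card : ℕ∞)

/-- The tree-decomposition is strongly linked: for all nodes `s ≠ t` there are
`min {|V_e| : e ∈ E(sTt)}` pairwise disjoint `V_s`–`V_t` paths. -/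
def StronglyLinked (D : TreeDecomp G T) : Prop :=
  ∀ s t : N, s ≠ t →
    ∃ c : Cardinal.{u},
      (∀ a b : N, D.EdgeOnPath s t a b → c ≤ Cardinal.mk ↥(D.adh a b)) ∧
      (∃ a b : N, D.EdgeOnPath s t a b ∧ c = Cardinal.mk ↥(D.adh a b)) ∧
      ∃ ι : Type u, Cardinal.mk ι = c ∧ DisjointPathsFam G (D.bag s) (D.bag t) ι

/-- One side of the separation of `G` induced by the edge `ab` of `T`: the union of the
bags over all nodes in the component of `T - ab` containing `a`. -/
def sideSet (D : TreeDecomp G T) (a b : N) : Set V :=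
  ⋃ x ∈ {x : N | b ∉ (D.path a x).support}, D.bag x

end TreeDecomp

/-- A rooted tree-decomposition. -/
structure RootedTreeDecomp (G : SimpleGraph V) (T : SimpleGraph N)
    extends TreeDecomp G T : Type (max u v) where
  root : N

namespace RootedTreeDecomp

variable {G : SimpleGraph V} {T : SimpleGraph N}

/-- The tree-order on `T` induced by the root: `s ≤ t` iff `s` lies on the path
from the root to `t`. -/
def le (D : RootedTreeDecomp G T) (s t : N) : Prop :=
  s ∈ (D.toTreeDecomp.path D.root t).support

/-- `st` is an edge of `T` with `s < t` in the tree-order. -/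
def IsOrientedEdge (D : RootedTreeDecomp G T) (s t : N) : Prop :=
  T.Adj s t ∧ D.le s t

/-- The vertex set of `G↑e` for the oriented edge `e = st`: the union of the bags over
all nodes of the component `T_e` of `T - e` not containing the root. -/
def above (D : RootedTreeDecomp G T) (t : N) : Set V :=
  ⋃ x ∈ {x : N | D.le t x}, D.bag x

/-- The vertex set of `G∘↑e` (the part strictly above `e`) for the oriented edge `e = st`. -/
def strictAbove (D : RootedTreeDecomp G T) (s t : N) : Set V :=
  D.above t \ (D.bag s ∩ D.bag t)

/-- The rooted tree-decomposition is componental. -/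
def Componental (D : RootedTreeDecomp G T) : Prop :=
  ∀ s t : N, D.IsOrientedEdge s t → (G.induce (D.strictAbove s t)).Connected

/-- The rooted tree-decomposition is tight. -/
def Tight (D : RootedTreeDecomp G T) : Prop :=
  ∀ s t : N, D.IsOrientedEdge s t →
    ∃ C : Set V, IsCompOf G (D.strictAbove s t) C ∧ NbhdSet G C = D.bag s ∩ D.bag t

/-- The rooted tree-decomposition is linked: for all comparable nodes `s < t` there are
`min {|V_e| : e ∈ E(sTt)}` pairwise disjoint `V_s`–`V_t` paths. -/
def Linked (D : RootedTreeDecomp G T) : Prop :=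
  ∀ s t : N, D.le s t → s ≠ t →
    ∃ c : Cardinal.{u},
      (∀ a b : N, D.toTreeDecomp.EdgeOnPath s t a b →
        c ≤ Cardinal.mk ↥(D.bag a ∩ D.bag b)) ∧
      (∃ a b : N, D.toTreeDecomp.EdgeOnPath s t a b ∧
        c = Cardinal.mk ↥(D.bag a ∩ D.bag b)) ∧
      ∃ ι : Type u, Cardinal.mk ι = c ∧ DisjointPathsFam G (D.bag s) (D.bag t) ι

/-- A rooted ray of `T`, i.e. a ray starting at the root. -/
def IsRootedRay (D : RootedTreeDecomp G T) (ρ : ℕ → N) : Prop :=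
  IsRay T ρ ∧ ρ 0 = D.root

/-- `liminf_{e ∈ E(R)} V_e`: the vertices lying in `V_e` for all but finitely many
edges `e` of the ray `R = ρ`. -/
def bagLiminf (D : RootedTreeDecomp G T) (ρ : ℕ → N) : Set V :=
  {v | ∃ M : ℕ, ∀ n ≥ M, v ∈ D.bag (ρ n) ∩ D.bag (ρ (n + 1))}

/-- `liminf_{e ∈ E(R)} |V_e|` for the ray `R = ρ`. -/
noncomputable def adhLiminf (D : RootedTreeDecomp G T) (ρ : ℕ → N) : ℕ∞ :=
  Filter.liminf (fun n : ℕ => (D.bag (ρ n) ∩ D.bag (ρ (n + 1))).encard) Filter.atTop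

/-- The end of the ray `r` of `G` gives rise to the rooted ray `ρ` of `T`: every ray
equivalent to `r` meets every bag along `ρ` only finitely often, and for every edge
`e = st` of `ρ` the component `C_G(V_s, ε)` is contained in `G∘↑e`. -/
def GivesRise (D : RootedTreeDecomp G T) (r : ℕ → V) (ρ : ℕ → N) : Prop :=
  D.IsRootedRay ρ ∧
  (∀ r' : ℕ → V, IsRay G r' → RayEquiv G r r' →
    ∀ n : ℕ, {k : ℕ | r' k ∈ D.bag (ρ n)}.Finite) ∧
  (∀ (n : ℕ) (v : V), InEndComp G (D.bag (ρ n)) r v →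
    v ∈ D.strictAbove (ρ n) (ρ (n + 1)))

end RootedTreeDecomp

/-- `{A, B}` is a separation of `G`. -/
def IsSeparation (G : SimpleGraph V) (A B : Set V) : Prop :=
  A ∪ B = Set.univ ∧ ∀ a ∈ A \ B, ∀ b ∈ B \ A, ¬ G.Adj a b

/-- The separation `{A, B}` separates the ends of `r` and `r'`: they live in components of
`G - (A ∩ B)` contained in different sides of `{A, B}`. -/
def SepSeparatesEnds (G : SimpleGraph V) (A B : Set V) (r r' : ℕ → V) : Prop :=
  ((∀ v, InEndComp G (A ∩ B) r v → v ∈ A \ B) ∧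
    (∀ v, InEndComp G (A ∩ B) r' v → v ∈ B \ A)) ∨
  ((∀ v, InEndComp G (A ∩ B) r v → v ∈ B \ A) ∧
    (∀ v, InEndComp G (A ∩ B) r' v → v ∈ A \ B))

/-- The separation `{A, B}` efficiently distinguishes the ends of `r` and `r'`. -/
def EffDistinguishes (G : SimpleGraph V) (A B : Set V) (r r' : ℕ → V) : Prop :=
  IsSeparation G A B ∧ SepSeparatesEnds G A B r r' ∧
    ∀ A' B' : Set V, IsSeparation G A' B' → SepSeparatesEnds G A' B' r r' →
      (A ∩ B).encard ≤ (A' ∩ B').encard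

/-- The tree-decomposition `D` distinguishes the ends of `r` and `r'` efficiently. -/
def TreeDecomp.EffDistinguishesEnds {G : SimpleGraph V} {T : SimpleGraph N}
    (D : TreeDecomp G T) (r r' : ℕ → V) : Prop :=
  ∃ a b : N, T.Adj a b ∧ EffDistinguishes G (D.sideSet a b) (D.sideSet b a) r r'

/-- `G` contains `H` as a minor. -/
def HasMinor {W : Type v} (G : SimpleGraph V) (H : SimpleGraph W) : Prop :=
  ∃ B : W → Set V, (∀ h, (B h).Nonempty) ∧ (∀ h, (G.induce (B h)).Connected) ∧
    (Pairwise fun h h' => Disjoint (B h) (B h')) ∧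
    ∀ ⦃h h'⦄, H.Adj h h' → ∃ u ∈ B h, ∃ w ∈ B h', G.Adj u w

/-- The half-grid: the graph on `ℕ × ℤ` in which `(i, j)` and `(i', j')` are adjacent
iff `|i - i'| + |j - j'| = 1`. -/
def halfGrid : SimpleGraph (ℕ × ℤ) :=
  SimpleGraph.fromRel fun p q =>
    ((p.1 : ℤ) - (q.1 : ℤ)).natAbs + (p.2 - q.2).natAbs = 1

/-- The one-way infinite path on `ℕ`. -/
def natRayGraph : SimpleGraph ℕ :=
  SimpleGraph.fromRel fun m n => n = m + 1

/-- The path on `m` vertices. -/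
def finPathGraph (m : ℕ) : SimpleGraph (Fin m) :=
  SimpleGraph.fromRel fun i j => (j : ℕ) = (i : ℕ) + 1

/-- The strong product of two graphs. -/
def strongProd {W : Type v} (G : SimpleGraph V) (H : SimpleGraph W) : SimpleGraph (V × W) :=
  SimpleGraph.fromRel fun x y =>
    (x.1 = y.1 ∨ G.Adj x.1 y.1) ∧ (x.2 = y.2 ∨ H.Adj x.2 y.2)

end CommonDefs

namespace TreeDecomp

variable {V : Type u} {N : Type v} {G : SimpleGraph V} {T : SimpleGraph N}

theorem path_isPath (D : TreeDecomp G T) (s t : N) : (D.path s t).IsPath :=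
  (D.isTree.existsUnique_path s t).choose_spec.1

theorem eq_path (D : TreeDecomp G T) {s t : N} {p : T.Walk s t} (hp : p.IsPath) :
    p = D.path s t :=
  (D.isTree.existsUnique_path s t).choose_spec.2 p hp

theorem mem_edges_of_mem_edges_path (D : TreeDecomp G T) {s t : N} {e : Sym2 N}
    (he : e ∈ (D.path s t).edges) (w : T.Walk s t) : e ∈ w.edges := by
  classical
  rw [← D.eq_path w.bypass_isPath] at he
  exact w.edges_bypass_subset_edges he

/-- The adhesion set of an edge on the path from `s` to `t` separates the bag of `s` from the
bag of `t`. -/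
theorem not_connAvoiding_adh (D : TreeDecomp G T) {s t a b : N} (he : D.EdgeOnPath s t a b)
    {x y : V} (hx : x ∈ D.bag s) (hy : y ∈ D.bag t) :
    ¬ ConnAvoiding G (D.adh a b) x y := by
  have key : ∀ {v : V}, v ∉ D.adh a b → ∀ {z z' : N}, v ∈ D.bag z → v ∈ D.bag z' →
      ∃ w : T.Walk z z', s(a, b) ∉ w.edges := by
    intro v hv z z' hz hz'
    refine ⟨D.path z z', fun hmem => hv ?_⟩
    have := D.bag_conn v _ (D.path_isPath z z') hz hz'
    exact ⟨this _ (Walk.fst_mem_support_of_mem_edges _ hmem),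
      this _ (Walk.snd_mem_support_of_mem_edges _ hmem)⟩
  rintro ⟨p, hp⟩
  have main : ∀ {u w : V} (q : G.Walk u w), (∀ v ∈ q.support, v ∉ D.adh a b) →
      ∀ {z z' : N}, u ∈ D.bag z → w ∈ D.bag z' → ∃ r : T.Walk z z', s(a, b) ∉ r.edges := by
    intro u w q
    induction q with
    | nil => intro hq z z' hz hz'; exact key (hq _ (by simp)) hz hz'
    | cons h q ih =>
      intro hq z z' hz hz'
      obtain ⟨m, hm, hm'⟩ := D.bag_edge h
      obtain ⟨r, hr⟩ := key (hq _ (by simp)) hz hm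
      obtain ⟨r', hr'⟩ := ih (fun v hv => hq v (by simp [hv])) hm' hz'
      exact ⟨r.append r', by simp [Walk.edges_append, hr, hr']⟩
  obtain ⟨r, hr⟩ := main p hp hx hy
  exact hr (D.mem_edges_of_mem_edges_path he.2 r)

end TreeDecomp

namespace RootedTreeDecomp

variable {V : Type u} {N : Type v} {G : SimpleGraph V} {T : SimpleGraph N}

theorem le_refl (D : RootedTreeDecomp G T) (t : N) : D.le t t := Walk.end_mem_support _

theorem finite_setOf_le (D : RootedTreeDecomp G T) (t : N) : {s | D.le s t}.Finite :=
  List.finite_toSet _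

theorem eq_of_adj_of_le_of_not_le (D : RootedTreeDecomp G T) {s t a b : N}
    (hst : D.IsOrientedEdge s t) (hab : T.Adj a b) (ha : D.le t a) (hb : ¬ D.le t b) :
    a = t ∧ b = s := by
  have hP := D.toTreeDecomp.path_isPath D.root
  have hac := D.isTree.isAcyclic
  have hba : b ∈ (D.toTreeDecomp.path D.root a).support := by
    by_contra h
    have h1 := hac.mem_support_of_ne_mem_support_of_adj_of_isPath (hP b) (hP a) hab.symm h
    have h2 := hac.path_concat (hP a) (hP b) hab h1
    refine hb ?_
    unfold le
    rw [h2, Walk.support_concat]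
    exact List.mem_append_left _ ha
  have h2 := hac.path_concat (hP b) (hP a) hab.symm hba
  have hat : a = t := by
    unfold le at ha hb
    rw [h2, Walk.support_concat] at ha
    simp only [List.mem_append, List.mem_singleton] at ha
    exact (ha.resolve_left hb).symm
  subst hat
  refine ⟨rfl, ?_⟩
  have h3 := hac.path_concat (hP s) (hP a) hst.1 hst.2
  have h4 := congrArg Walk.penultimate (h2.symm.trans h3)
  simpa using h4

theorem le_of_mem_strictAbove (D : RootedTreeDecomp G T) {s t x : N} {v : V}
    (hst : D.IsOrientedEdge s t) (hv : v ∈ D.strictAbove s t) (hx : v ∈ D.bag x) :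
    D.le t x := by
  by_contra hcon
  obtain ⟨hva, hvn⟩ := hv
  simp only [above, Set.mem_iUnion, Set.mem_ofPred_eq] at hva
  obtain ⟨y, hy, hvy⟩ := hva
  obtain ⟨d, hd, h1, h2⟩ := (D.toTreeDecomp.path y x).exists_boundary_dart {z | D.le t z} hy hcon
  obtain ⟨h3, h4⟩ := D.eq_of_adj_of_le_of_not_le hst d.adj h1 h2
  have := D.bag_conn v _ (D.toTreeDecomp.path_isPath y x) hvy hx
  exact hvn ⟨h4 ▸ this _ (Walk.dart_snd_mem_support_of_mem_darts _ hd),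
    h3 ▸ this _ (Walk.dart_fst_mem_support_of_mem_darts _ hd)⟩

theorem isOrientedEdge_or (D : RootedTreeDecomp G T) {a b : N} (h : T.Adj a b) :
    D.IsOrientedEdge a b ∨ D.IsOrientedEdge b a := by
  have hP := D.toTreeDecomp.path_isPath D.root
  by_cases hb : b ∈ (D.toTreeDecomp.path D.root a).support
  · exact Or.inr ⟨h.symm, hb⟩
  · exact Or.inl ⟨h, D.isTree.isAcyclic.mem_support_of_ne_mem_support_of_adj_of_isPath
      (hP b) (hP a) h.symm hb⟩

theorem exists_isOrientedEdge (D : RootedTreeDecomp G T) {t : N} (ht : t ≠ D.root) :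
    ∃ s, D.IsOrientedEdge s t := by
  have hn : ¬ (D.toTreeDecomp.path D.root t).Nil := Walk.not_nil_of_ne ht.symm
  exact ⟨_, Walk.adj_penultimate hn, Walk.getVert_mem_support _ _⟩

/-- In a tight rooted tree-decomposition of a locally finite graph every vertex lies in only
finitely many adhesion sets. -/
theorem Tight.finite_adhesion {D : RootedTreeDecomp G T} (hD : D.Tight) (hG : LocFin G) (f : V) :
    {t | ∃ s, D.IsOrientedEdge s t ∧ f ∈ D.bag s ∩ D.bag t}.Finite := by
  choose x hx using D.bag_cover
  refine ((hG f).biUnion fun u _ => D.finite_setOf_le (x u)).subset ?_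
  rintro t ⟨s, hst, hf⟩
  obtain ⟨C, hC, hN⟩ := hD s t hst
  rw [← hN] at hf
  obtain ⟨-, u, hu, huf⟩ := hf
  simp only [Set.mem_iUnion]
  exact ⟨u, huf.symm, D.le_of_mem_strictAbove hst (hC.2.1 hu) (hx u)⟩

theorem Tight.finite_setOf_mem_bag {D : RootedTreeDecomp G T} (hD : D.Tight) (hG : LocFin G)
    (f : V) : {t | f ∈ D.bag t}.Finite := by
  obtain ⟨x, hx⟩ := D.bag_cover f
  refine (((hD.finite_adhesion hG f).biUnion fun t _ => D.finite_setOf_le t).union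
    (Set.finite_singleton x)).subset ?_
  intro y hy
  by_cases hyx : y = x
  · exact Or.inr hyx
  left
  have hn : ¬ (D.toTreeDecomp.path y x).Nil := Walk.not_nil_of_ne hyx
  have hb : f ∈ D.bag (D.toTreeDecomp.path y x).snd :=
    D.bag_conn f _ (D.toTreeDecomp.path_isPath y x) hy hx _ (Walk.getVert_mem_support _ _)
  simp only [Set.mem_iUnion]
  rcases D.isOrientedEdge_or (Walk.adj_snd hn) with h | h
  · exact ⟨_, ⟨_, h, hy, hb⟩, h.2⟩
  · exact ⟨_, ⟨_, h, hb, hy⟩, D.le_refl y⟩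

/-- The sizes of the adhesion sets containing a given vertex are bounded. -/
theorem Tight.exists_ncard_adh_le {D : RootedTreeDecomp G T} (hD : D.Tight) (hG : LocFin G)
    (hfin : D.toTreeDecomp.FiniteParts) (f : V) :
    ∃ n : ℕ, ∀ a b, f ∈ D.toTreeDecomp.adh a b → (D.toTreeDecomp.adh a b).ncard ≤ n := by
  have hF := hD.finite_setOf_mem_bag hG f
  obtain ⟨n, hn⟩ := (hF.image fun t => (D.bag t).ncard).bddAbove
  exact ⟨n, fun a b h => (Set.ncard_le_ncard Set.inter_subset_left (hfin a)).trans
    (hn ⟨a, h.1, rfl⟩)⟩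

/-- Arbitrarily far away from a finite set `W`, and close to a given infinite set `I`, there is a
bag contained in the closed neighbourhood of a connected set `C` and containing the
neighbourhood of `C`. -/
theorem exists_bag_far {D : RootedTreeDecomp G T} (ht : D.Tight) (hc : D.Componental)
    (hfin : D.toTreeDecomp.FiniteParts) (hG : LocFin G) {W I : Set V} (hW : W.Finite)
    (hI : I.Infinite) :
    ∃ (x : N) (C : Set V), (G.induce C).Connected ∧ D.bag x ⊆ C ∪ NbhdSet G C ∧
      NbhdSet G C ⊆ D.bag x ∧ Disjoint (C ∪ NbhdSet G C) W ∧
      (I ∩ (C ∪ NbhdSet G C)).Nonempty := by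
  set P : Set N := (⋃ w ∈ W, ⋃ y ∈ {y | w ∈ D.bag y}, {x | D.le x y}) ∪ {D.root} with hP
  have hPfin : P.Finite := (hW.biUnion fun w _ => (ht.finite_setOf_mem_bag hG w).biUnion
    fun y _ => D.finite_setOf_le y).union (Set.finite_singleton _)
  obtain ⟨v, hvI, hv⟩ := (hI.sdiff (hPfin.biUnion fun x _ => hfin x)).nonempty
  obtain ⟨x, hx⟩ := D.bag_cover v
  have hxP : x ∉ P := fun h => hv (Set.mem_biUnion h hx)
  have hxr : x ≠ D.root := fun h => hxP (Or.inr h)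
  have hxW : ∀ y, D.le x y → ∀ w ∈ W, w ∉ D.bag y := fun y hy w hw hwy =>
    hxP (Or.inl (Set.mem_biUnion hw (Set.mem_biUnion (show y ∈ {y | w ∈ D.bag y} from hwy) hy)))
  obtain ⟨s, hs⟩ := D.exists_isOrientedEdge hxr
  have hxa : D.bag x ⊆ D.above x := fun z hz => Set.mem_biUnion (D.le_refl x) hz
  have hN : NbhdSet G (D.strictAbove s x) = D.bag s ∩ D.bag x := by
    apply Set.Subset.antisymm
    · rintro z ⟨hz, u, hu, huz⟩
      obtain ⟨y, hy, hy'⟩ := D.bag_edge huz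
      have hza : z ∈ D.above x :=
        Set.mem_biUnion (D.le_of_mem_strictAbove hs hu hy) hy'
      by_contra hcon
      exact hz ⟨hza, hcon⟩
    · intro z hz
      obtain ⟨C, hC, hNC⟩ := ht s x hs
      refine ⟨fun h => h.2 hz, ?_⟩
      rw [← hNC] at hz
      obtain ⟨-, u, hu, huz⟩ := hz
      exact ⟨u, hC.2.1 hu, huz⟩
  have hunion : D.strictAbove s x ∪ NbhdSet G (D.strictAbove s x) = D.above x := by
    rw [hN]
    exact Set.sdiff_union_of_subset (Set.inter_subset_right.trans hxa)
  refine ⟨x, D.strictAbove s x, hc s x hs, hunion ▸ hxa, hN ▸ Set.inter_subset_right, ?_, v, hvI,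
    hunion ▸ hxa hx⟩
  rw [hunion, Set.disjoint_left]
  intro z hz hzW
  simp only [above, Set.mem_iUnion, Set.mem_ofPred_eq] at hz
  obtain ⟨y, hy, hzy⟩ := hz
  exact hxW y hy z hzW hzy

end RootedTreeDecomp

/-- The levels from which the counterexample is built: two rays `A` and `M`, joined by the
single vertices `F`, with a further ray `L i` attached to `A i` and `A (i + 1)` for every `i`. -/
inductive Level : Type
  | A (y : ℕ)
  | M (y : ℕ)
  | F (y : ℕ)
  | L (i n : ℕ)

namespace Level

/-- The number of vertices of the counterexample in a given level. -/
def weight : Level → ℕ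
  | A y => y + 2
  | M y => y + 2
  | F _ => 1
  | L i _ => 2 * i + 5

/-- The (directed) edges between levels. -/
inductive Link : Level → Level → Prop
  | stepA (y : ℕ) : Link (A y) (A (y + 1))
  | stepM (y : ℕ) : Link (M y) (M (y + 1))
  | toA (y : ℕ) : Link (F y) (A y)
  | toM (y : ℕ) : Link (F y) (M y)
  | stepL (i n : ℕ) : Link (L i n) (L i (n + 1))
  | toLower (i : ℕ) : Link (L i 0) (A i)
  | toUpper (i : ℕ) : Link (L i 0) (A (i + 1))

/-- Two levels are near if they are equal or linked. -/
def Near (a b : Level) : Prop := a = b ∨ Link a b ∨ Link b a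

theorem Near.symm {a b : Level} (h : Near a b) : Near b a := by
  rcases h with h | h | h
  · exact Or.inl h.symm
  · exact Or.inr (Or.inr h)
  · exact Or.inr (Or.inl h)

theorem Link.near {a b : Level} (h : Link a b) : Near a b := Or.inr (Or.inl h)

theorem weight_pos (a : Level) : 0 < a.weight := by
  cases a <;> simp [weight]

theorem finite_setOf_near (a : Level) : {b | Near a b}.Finite := by
  cases a with
  | A y =>
    refine (Set.toFinite {A y, A (y + 1), A (y - 1), F y, L y 0, L (y - 1) 0}).subset ?_
    rintro b (rfl | h | h)
    · simp
    · cases h; simp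
    · cases h <;> simp
  | M y =>
    refine (Set.toFinite {M y, M (y + 1), M (y - 1), F y}).subset ?_
    rintro b (rfl | h | h)
    · simp
    · cases h; simp
    · cases h <;> simp
  | F y =>
    refine (Set.toFinite {F y, A y, M y}).subset ?_
    rintro b (rfl | h | h)
    · simp
    · cases h <;> simp
    · cases h
  | L i n =>
    refine (Set.toFinite {L i n, L i (n + 1), L i (n - 1), A i, A (i + 1)}).subset ?_
    rintro b (rfl | h | h)
    · simp
    · cases h <;> simp
    · cases h; simp

instance : Countable Level := by
  have hinj : Function.Injective (fun a : Level => match a with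
      | A y => ((0, y, 0) : ℕ × ℕ × ℕ)
      | M y => (1, y, 0)
      | F y => (2, y, 0)
      | L i n => (3, i, n)) := by
    intro a b h
    cases a <;> cases b <;> simp_all
  exact hinj.countable

instance : Infinite Level :=
  Infinite.of_injective A fun _ _ h => A.inj h

/-- The levels on the side of the rays `L r`, for `r ≤ i`, of the `i`-th separator. -/
def Inner (i : ℕ) : Level → Prop
  | A y => y ≤ i
  | L r _ => r ≤ i
  | _ => False

open Classical in
/-- The levels forming the `i`-th separator. -/
noncomputable def border (i : ℕ) : Finset Level :=
  insert (A (i + 1)) ((Finset.range (i + 1)).image F)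

theorem mem_border_of_near {i : ℕ} {a b : Level} (h : Near a b) (ha : Inner i a)
    (hb : ¬ Inner i b) : b ∈ border i := by
  rcases h with rfl | h | h
  · exact absurd ha hb
  · cases h <;> simp_all [Inner, border] <;> omega
  · cases h <;> simp_all [Inner, border] <;> omega

theorem sum_weight_image_F (s : Finset ℕ) [DecidableEq Level] :
    ∑ a ∈ s.image F, a.weight = s.card := by
  rw [Finset.sum_image fun _ _ _ _ h => F.inj h]
  simp [weight]

theorem sum_weight_border (i : ℕ) : ∑ a ∈ border i, a.weight = 2 * i + 4 := by
  classical
  rw [border, Finset.sum_insert (by simp), sum_weight_image_F]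
  simp [weight]
  omega

/-- If a set of blocked levels of small total weight separates `L i p` from `M q`, then `F 0`
is blocked, and the total weight is large. Here `R` is the set of levels that can be reached. -/
theorem blocked_F_zero {R B : Level → Prop} {i p q k : ℕ}
    (step : ∀ a b, R a → ¬ B a → Near a b → R b)
    (hB : ∀ Q : Finset Level, (∀ a ∈ Q, B a) → ∑ a ∈ Q, a.weight ≤ k)
    (hk : k ≤ 2 * i + 4) (hp : R (L i p)) (hq : 2 * i + 3 ≤ q) (hRq : ¬ R (M q)) :
    B (F 0) ∧ i + 3 ≤ k := by
  classical
  have single : ∀ a, B a → a.weight ≤ k := fun a ha => by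
    simpa using hB {a} (by simpa using ha)
  have hL : ∀ n, ¬ B (L i n) := fun n h => by
    have := single _ h
    simp only [weight] at this
    omega
  have hMfar : ∀ j, 2 * i + 3 ≤ j → ¬ B (M j) := fun j hj h => by
    have := single _ h
    simp only [weight] at this
    omega
  have climbM : ∀ y n, (∀ j, y ≤ j → j < y + n → ¬ B (M j)) → R (M y) → R (M (y + n)) := by
    intro y n h hy
    induction n with
    | zero => exact hy
    | succ n ih =>
      exact step _ _ (ih fun j h1 h2 => h j h1 (by omega)) (h _ (by omega) (by omega))
        (Link.stepM _).near
  have hRM : ∀ j, 2 * i + 3 ≤ j → ¬ R (M j) := by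
    intro j hj h
    rcases le_total j q with hjq | hjq
    · obtain ⟨n, rfl⟩ := Nat.exists_eq_add_of_le hjq
      exact hRq (climbM j n (fun l h1 _ => hMfar l (hj.trans h1)) h)
    · obtain ⟨n, rfl⟩ := Nat.exists_eq_add_of_le hjq
      clear hj hjq
      induction n with
      | zero => exact hRq h
      | succ n ih =>
        exact ih (step _ _ h (hMfar _ (by omega)) (Link.stepM (q + n)).near.symm)
  have hL0 : R (L i 0) := by
    induction p with
    | zero => exact hp
    | succ p ih => exact ih (step _ _ hp (hL _) (Link.stepL i p).near.symm)
  obtain ⟨y₀, hy₀, hBy₀⟩ : ∃ y₀, i < y₀ ∧ B (A y₀) := by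
    by_contra! hcon
    have hA : ∀ n, R (A (i + 1 + n)) := by
      intro n
      induction n with
      | zero => exact step _ _ hL0 (hL 0) (Link.toUpper i).near
      | succ n ih => exact step _ _ ih (hcon _ (by omega)) (Link.stepA _).near
    have hF : ∀ y, 2 * i + 3 ≤ y → B (F y) := by
      intro y hy
      by_contra h
      obtain ⟨n, rfl⟩ := Nat.exists_eq_add_of_le (show i + 1 ≤ y by omega)
      exact hRM _ hy (step _ _ (step _ _ (hA n) (hcon _ (by omega)) (Link.toA _).near.symm) h
        (Link.toM _).near)
    have := hB ((Finset.Ico (2 * i + 3) (4 * i + 8)).image F) (by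
      intro a ha
      obtain ⟨y, hy, rfl⟩ := Finset.mem_image.1 ha
      exact hF y (Finset.mem_Ico.1 hy).1)
    rw [sum_weight_image_F, Nat.card_Ico] at this
    omega
  have hk' : i + 3 ≤ k := by
    have := single _ hBy₀
    simp only [weight] at this
    omega
  refine ⟨?_, hk'⟩
  have light : ∀ Q : Finset Level, (∀ a ∈ Q, B a) → A y₀ ∉ Q → ∑ a ∈ Q, a.weight ≤ i + 1 := by
    intro Q hQ hn
    have := hB (insert (A y₀) Q) (by simpa [hBy₀] using hQ)
    rw [Finset.sum_insert hn, show (A y₀).weight = y₀ + 2 from rfl] at this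
    omega
  have free : ∀ z ≤ i, (∀ w, z < w → w ≤ i → B (F w)) → ∀ a : Level, a.weight = z + 2 →
      a ≠ A y₀ → (∀ w, a ≠ F w) → ¬ B a := by
    intro z hz hF a ha ha₀ haF h
    have := light (insert a ((Finset.Ioc z i).image F)) (by
        simp only [Finset.mem_insert, Finset.mem_image, Finset.mem_Ioc]
        rintro b (rfl | ⟨w, ⟨h1, h2⟩, rfl⟩)
        · exact h
        · exact hF w h1 h2) (by simpa using ha₀.symm)
    rw [Finset.sum_insert (by simpa using fun w _ _ => (haF w).symm), sum_weight_image_F, ha,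
      Nat.card_Ioc] at this
    omega
  have descend : ∀ m y, y + m = i + 1 → ∀ z, y ≤ z → z ≤ i →
      R (A z) ∧ ¬ B (A z) ∧ ¬ B (M z) ∧ B (F z) := by
    intro m
    induction m with
    | zero => intro y hy z h1 h2; omega
    | succ m ih =>
      intro y hy z h1 h2
      have ih := ih (y + 1) (by omega)
      rcases h1.lt_or_eq with h1 | rfl
      · exact ih z h1 h2
      have hF : ∀ w, y < w → w ≤ i → B (F w) := fun w h1 h2 => (ih w h1 h2).2.2.2
      have hA : ¬ B (A y) := free y h2 hF _ rfl (by simp; omega) (by simp)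
      have hM : ¬ B (M y) := free y h2 hF _ rfl (by simp) (by simp)
      have hRA : R (A y) := by
        rcases h2.lt_or_eq with h2 | rfl
        · obtain ⟨h3, h4, -⟩ := ih (y + 1) le_rfl h2
          exact step _ _ h3 h4 (Link.stepA y).near.symm
        · exact step _ _ hL0 (hL 0) (Link.toLower y).near
      refine ⟨hRA, hA, hM, ?_⟩
      by_contra hcon
      have hRMy : R (M y) :=
        step _ _ (step _ _ hRA hA (Link.toA y).near.symm) hcon (Link.toM y).near
      refine hRM (y + (2 * i + 3)) (by omega) (climbM y _ (fun j h3 _ => ?_) hRMy)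
      rcases h3.lt_or_eq with h3 | rfl
      · by_cases hj : j ≤ i
        · exact (ih j h3 hj).2.2.1
        · intro hMj
          have := light {M j} (by simpa using hMj) (by simp)
          simp only [Finset.sum_singleton, weight] at this
          omega
      · exact hM
  exact (descend (i + 1) 0 (by omega) 0 le_rfl (Nat.zero_le i)).2.2.2

end Level

/-- The graph obtained from the levels by replacing every level by a clique (the fibre of `π`),
with all edges between the cliques of linked levels. -/
def levelGraph {V : Type u} (π : V → Level) : SimpleGraph V where
  Adj x y := x ≠ y ∧ (π x).Near (π y)
  symm := ⟨fun _ _ h => ⟨h.1.symm, h.2.symm⟩⟩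
  loopless := ⟨fun _ h => h.1 rfl⟩

/-- The fibres of `π` have the sizes given by the weights. -/
def HasLevelSizes {V : Type u} (π : V → Level) : Prop :=
  ∀ a : Level, (π ⁻¹' {a}).ncard = a.weight

/-- There is a partition of `ℕ` into levels of the prescribed sizes. -/
theorem exists_hasLevelSizes : ∃ π : ℕ → Level, HasLevelSizes π := by
  have : Infinite (Σ a : Level, Fin a.weight) :=
    Infinite.of_injective (fun a : Level => (⟨a, 0, a.weight_pos⟩ : Σ a : Level, Fin a.weight))
      fun _ _ h => congrArg Sigma.fst h
  obtain ⟨h⟩ := nonempty_denumerable (Σ a : Level, Fin a.weight)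
  let e := Denumerable.eqv (Σ a : Level, Fin a.weight)
  refine ⟨fun n => (e.symm n).1, fun a => ?_⟩
  have h : (fun n => (e.symm n).1) ⁻¹' {a} =
      Set.range fun j : Fin a.weight => e ⟨a, j⟩ := by
    ext n
    constructor
    · rintro rfl
      exact ⟨(e.symm n).2, by simp⟩
    · rintro ⟨j, rfl⟩
      simp
  have hinj : Function.Injective fun j : Fin a.weight => e ⟨a, j⟩ :=
    e.injective.comp sigma_mk_injective
  rw [h, ← Set.image_univ, Set.ncard_image_of_injective _ hinj, Set.ncard_univ, Nat.card_fin]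

namespace HasLevelSizes

variable {V : Type u} {π : V → Level}

theorem finite_fibre (hπ : HasLevelSizes π) (a : Level) : (π ⁻¹' {a}).Finite :=
  Set.finite_of_ncard_pos (by rw [hπ a]; exact a.weight_pos)

theorem exists_eq (hπ : HasLevelSizes π) (a : Level) : ∃ x, π x = a := by
  have h : (π ⁻¹' {a}).Nonempty :=
    Set.nonempty_of_ncard_ne_zero (by rw [hπ a]; exact a.weight_pos.ne')
  exact h

theorem finite_preimage (hπ : HasLevelSizes π) {s : Set Level} (hs : s.Finite) :
    (π ⁻¹' s).Finite :=
  hs.preimage' fun a _ => hπ.finite_fibre a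

theorem ncard_preimage (hπ : HasLevelSizes π) (Q : Finset Level) :
    (π ⁻¹' (Q : Set Level)).ncard = ∑ a ∈ Q, a.weight := by
  classical
  have hfin := hπ.finite_preimage Q.finite_toSet
  rw [Set.ncard_eq_toFinset_card _ hfin,
    Finset.card_eq_sum_card_fiberwise (f := π) (t := Q) (by intro x hx; simpa using hx)]
  refine Finset.sum_congr rfl fun a ha => ?_
  rw [← hπ a, ← Set.ncard_coe_finset]
  congr 1
  ext x
  simp only [Finset.coe_filter, Set.Finite.mem_toFinset, Set.mem_preimage, Finset.mem_coe,
    Set.mem_ofPred_eq, Set.mem_singleton_iff]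
  exact ⟨fun h => h.2, fun h => ⟨h ▸ ha, h⟩⟩

theorem locFin (hπ : HasLevelSizes π) : LocFin (levelGraph π) := fun v =>
  (hπ.finite_preimage (π v).finite_setOf_near).subset fun _ h => h.2

end HasLevelSizes

section Reach

variable {V : Type u} {π : V → Level}

theorem connAvoiding_step {S : Set V} {x y z : V} (h : ConnAvoiding (levelGraph π) S x y)
    (hyz : (π y).Near (π z)) (hz : z ∉ S) : ConnAvoiding (levelGraph π) S x z := by
  by_cases hne : y = z
  · exact hne ▸ h
  obtain ⟨p, hp⟩ := h
  have hadj : (levelGraph π).Adj y z := ⟨hne, hyz⟩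
  refine ⟨p.concat hadj, fun w hw => ?_⟩
  rw [Walk.support_concat, List.mem_append, List.mem_singleton] at hw
  rcases hw with hw | rfl
  · exact hp w hw
  · exact hz

theorem HasLevelSizes.connected (hπ : HasLevelSizes π) : (levelGraph π).Connected := by
  obtain ⟨x, hx⟩ := hπ.exists_eq (.A 0)
  have step : ∀ {a b : Level}, (∀ y, π y = a → (levelGraph π).Reachable x y) →
      a.Near b → ∀ z, π z = b → (levelGraph π).Reachable x z := by
    rintro a b h hab z rfl
    obtain ⟨y, rfl⟩ := hπ.exists_eq a
    by_cases hne : y = z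
    · exact hne ▸ h y rfl
    · exact (h y rfl).trans (Adj.reachable ⟨hne, hab⟩)
  have hA : ∀ n y, π y = .A n → (levelGraph π).Reachable x y := by
    intro n
    induction n with
    | zero =>
      intro y hy
      by_cases hne : x = y
      · exact hne ▸ Reachable.refl _
      · exact Adj.reachable ⟨hne, Or.inl (hx.trans hy.symm)⟩
    | succ n ih => exact step ih (Level.Link.stepA n).near
  have hF := fun n => step (hA n) (Level.Link.toA n).near.symm
  have hL : ∀ i n y, π y = .L i n → (levelGraph π).Reachable x y := by
    intro i n
    induction n with
    | zero => exact step (hA i) (Level.Link.toLower i).near.symm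
    | succ n ih => exact step ih (Level.Link.stepL i n).near
  have all : ∀ y, (levelGraph π).Reachable x y := by
    intro y
    cases h : π y with
    | A n => exact hA n y h
    | M n => exact step (hF n) (Level.Link.toM n).near y h
    | F n => exact hF n y h
    | L i n => exact hL i n y h
  exact (connected_iff _).2 ⟨fun y z => (all y).symm.trans (all z), ⟨x⟩⟩

/-- A set of at most `2 * i + 4` vertices separating the levels `L i p` and `M q`
has more than `i` elements and contains the level `F 0`. -/
theorem HasLevelSizes.preimage_F_zero_subset (hπ : HasLevelSizes π) {S : Set V} (hS : S.Finite)
    {i p q : ℕ} (hcard : S.ncard ≤ 2 * i + 4) (hq : 2 * i + 3 ≤ q)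
    (hsep : ∀ x y, π x = .L i p → π y = .M q → ¬ ConnAvoiding (levelGraph π) S x y) :
    π ⁻¹' {.F 0} ⊆ S ∧ i + 3 ≤ S.ncard := by
  have hB : ∀ Q : Finset Level, (∀ a ∈ Q, π ⁻¹' {a} ⊆ S) → ∑ a ∈ Q, a.weight ≤ S.ncard := by
    intro Q hQ
    rw [← hπ.ncard_preimage]
    exact Set.ncard_le_ncard (fun x hx => hQ (π x) hx rfl) hS
  have free : ∀ a : Level, 2 * i + 4 < a.weight → ∃ x, π x = a ∧ x ∉ S := by
    intro a ha
    refine Set.not_subset.1 fun h => ?_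
    have := hB {a} fun b hb => by rwa [Finset.mem_singleton.1 hb]
    rw [Finset.sum_singleton] at this
    omega
  obtain ⟨x, hx, hxS⟩ := free (.L i p) (by simp [Level.weight])
  obtain ⟨y, hy, hyS⟩ := free (.M q) (by simp only [Level.weight]; omega)
  refine Level.blocked_F_zero (R := fun a => ∀ z, π z = a → z ∉ S →
    ConnAvoiding (levelGraph π) S x z) (p := p) ?_ hB hcard ?_ hq
    fun h => hsep x y hx hy (h y hy hyS)
  · rintro a b ha hab hnear z rfl hz
    obtain ⟨w, rfl, hw⟩ := Set.not_subset.1 hab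
    exact connAvoiding_step (ha w rfl hw) hnear hz
  · intro z hz hzS
    exact connAvoiding_step ⟨Walk.nil, by simpa using hxS⟩ (Or.inl (hx.trans hz.symm)) hzS

theorem subset_of_connected_of_disjoint {G : SimpleGraph V} {C K X : Set V}
    (hC : (G.induce C).Connected) (hK : ∀ u ∈ K, ∀ v ∉ K, G.Adj u v → v ∈ X)
    (hX : Disjoint (C ∪ NbhdSet G C) X) (hCK : ((C ∪ NbhdSet G C) ∩ K).Nonempty) :
    C ∪ NbhdSet G C ⊆ K := by
  have hX' : ∀ v ∈ C ∪ NbhdSet G C, v ∉ X := fun v hv => Set.disjoint_left.1 hX hv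
  obtain ⟨u, huC, huK⟩ : (C ∩ K).Nonempty := by
    obtain ⟨v, hv | hv, hvK⟩ := hCK
    · exact ⟨v, hv, hvK⟩
    · obtain ⟨-, u, hu, huv⟩ := hv
      refine ⟨u, hu, ?_⟩
      by_contra huK
      exact hX' u (Or.inl hu) (hK v hvK u huK huv.symm)
  have hsub : C ⊆ K := by
    intro v hv
    by_contra hvK
    obtain ⟨p⟩ := hC.preconnected ⟨u, huC⟩ ⟨v, hv⟩
    obtain ⟨d, -, h1, h2⟩ := p.exists_boundary_dart {z | z.1 ∈ K} huK hvK
    exact hX' _ (Or.inl d.snd.2) (hK _ h1 _ h2 d.adj)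
  rintro v (hv | hv)
  · exact hsub hv
  · by_contra hvK
    obtain ⟨-, u, hu, huv⟩ := id hv
    exact hX' v (Or.inr hv) (hK u (hsub hu) v hvK huv)

/-- If `C` meets a sequence of levels but not its first one, then its neighbourhood contains
one of these levels. -/
theorem exists_level_subset_nbhdSet {C : Set V} {l : ℕ → Level}
    (hl : ∀ n, (l n).Near (l (n + 1))) {n : ℕ} (hn : (C ∩ π ⁻¹' {l n}).Nonempty)
    (h0 : Disjoint C (π ⁻¹' {l 0})) : ∃ m, π ⁻¹' {l m} ⊆ NbhdSet (levelGraph π) C := by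
  classical
  have hex : ∃ n, (C ∩ π ⁻¹' {l n}).Nonempty := ⟨n, hn⟩
  obtain ⟨u, huC, hu⟩ := Nat.find_spec hex
  have hmin := fun {m} => Nat.find_min hex (m := m)
  cases hk : Nat.find hex with
  | zero =>
    rw [hk] at hu
    exact absurd hu (Set.disjoint_left.1 h0 huC)
  | succ m =>
    rw [hk] at hu
    refine ⟨m, fun z hz => ?_⟩
    have hzC : z ∉ C := fun h => hmin (by omega) ⟨z, h, hz⟩
    rw [Set.mem_preimage, Set.mem_singleton_iff] at hu hz
    refine ⟨hzC, u, huC, fun h => hzC (h ▸ huC), ?_⟩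
    rw [hu, hz]
    exact (hl m).symm

end Reach

section Nodes

variable {V : Type u} {π : V → Level} {N : Type v} {T : SimpleGraph N}
  {D : RootedTreeDecomp (levelGraph π) T}

theorem mem_border_of_adj {i : ℕ} {u v : V} (hu : u ∈ π ⁻¹' {a | a.Inner i})
    (hv : v ∉ π ⁻¹' {a | a.Inner i}) (h : (levelGraph π).Adj u v) :
    v ∈ π ⁻¹' (Level.border i : Set Level) :=
  Level.mem_border_of_near h.2 hu hv

theorem HasLevelSizes.infinite_preimage (hπ : HasLevelSizes π) {l : ℕ → Level}
    (hl : Function.Injective l) : (π ⁻¹' Set.range l).Infinite := by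
  choose x hx using hπ.exists_eq
  refine Set.infinite_of_injective_forall_mem (f := x ∘ l) (fun m n h => hl ?_) fun n => ?_
  · simpa [hx] using congrArg π h
  · simp [hx]

theorem exists_inner_bag (hπ : HasLevelSizes π) (ht : D.Tight) (hc : D.Componental)
    (hfin : D.toTreeDecomp.FiniteParts) (i : ℕ) :
    ∃ s p, π ⁻¹' {.L i p} ⊆ D.bag s ∧ D.bag s ⊆ π ⁻¹' {a | a.Inner i} := by
  obtain ⟨s, C, hC, h1, h2, hW, v, ⟨n, hn⟩, hv⟩ := D.exists_bag_far ht hc hfin hπ.locFin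
    (W := π ⁻¹' {.L i 0} ∪ π ⁻¹' (Level.border i : Set Level)) (I := π ⁻¹' Set.range (.L i))
    ((hπ.finite_fibre _).union (hπ.finite_preimage (Finset.finite_toSet _)))
    (hπ.infinite_preimage fun _ _ h => (Level.L.inj h).2)
  rw [Set.disjoint_union_right] at hW
  obtain ⟨m, hm⟩ : ∃ m, (C ∩ π ⁻¹' {.L i m}).Nonempty := by
    rcases hv with hv | hv
    · exact ⟨n, v, hv, hn.symm⟩
    · have hn0 : n ≠ 0 := by
        rintro rfl
        exact Set.disjoint_left.1 hW.1 (Or.inr hv) hn.symm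
      obtain ⟨-, u, hu, -, huv⟩ := hv
      rw [← hn] at huv
      rcases huv with h | h | h
      · exact ⟨n, u, hu, h⟩
      · generalize hb : π u = b at h
        cases h with
        | stepL i n => exact ⟨n, u, hu, hb⟩
      · generalize hb : π u = b at h
        cases h with
        | stepL i n => exact ⟨n + 1, u, hu, hb⟩
        | toLower | toUpper => exact absurd rfl hn0
  obtain ⟨p, hp⟩ := exists_level_subset_nbhdSet (fun n => (Level.Link.stepL i n).near) hm
    (hW.1.mono_left Set.subset_union_left)
  refine ⟨s, p, hp.trans h2, h1.trans (subset_of_connected_of_disjoint hC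
    (fun u hu v hv => mem_border_of_adj hu hv) hW.2 ?_)⟩
  obtain ⟨z, hz⟩ := hπ.exists_eq (.L i p)
  refine ⟨z, Or.inr (hp hz), ?_⟩
  simp [hz, Level.Inner]

theorem exists_outer_bag (hπ : HasLevelSizes π) (ht : D.Tight) (hc : D.Componental)
    (hfin : D.toTreeDecomp.FiniteParts) (i k : ℕ) :
    ∃ t q, k ≤ q ∧ π ⁻¹' {.M q} ⊆ D.bag t ∧ Disjoint (D.bag t) (π ⁻¹' {a | a.Inner i}) := by
  obtain ⟨t, C, hC, h1, h2, hW, v, ⟨n, hn⟩, hv⟩ := D.exists_bag_far ht hc hfin hπ.locFin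
    (W := π ⁻¹' (Level.M '' Set.Iic k) ∪ π ⁻¹' (Level.border i : Set Level))
    (I := π ⁻¹' Set.range .M)
    ((hπ.finite_preimage ((Set.finite_Iic k).image _)).union
      (hπ.finite_preimage (Finset.finite_toSet _)))
    (hπ.infinite_preimage fun _ _ h => Level.M.inj h)
  rw [Set.disjoint_union_right] at hW
  obtain ⟨q, hq⟩ : ∃ q, π ⁻¹' {.M q} ⊆ NbhdSet (levelGraph π) C := by
    by_cases hm : ∃ m, (C ∩ π ⁻¹' {.M m}).Nonempty
    · obtain ⟨m, hm⟩ := hm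
      refine exists_level_subset_nbhdSet (fun n => (Level.Link.stepM n).near) hm
        ((hW.1.mono_left Set.subset_union_left).mono_right (Set.preimage_mono ?_))
      simp
    · have hM : ∀ m, ∀ z ∈ C, π z ≠ .M m := fun m z hz h => hm ⟨m, z, hz, h⟩
      have hvC := hv.resolve_left fun h => hM n v h hn.symm
      obtain ⟨-, u, hu, -, huv⟩ := hvC
      refine ⟨n, fun z hz => ⟨fun h => hM n z h hz, u, hu, ?_, ?_⟩⟩
      · rintro rfl
        exact hM n u hu hz
      · rw [Set.mem_preimage, Set.mem_singleton_iff] at hz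
        rwa [hz, hn]
  obtain ⟨z, hz⟩ := hπ.exists_eq (.M q)
  refine ⟨t, q, ?_, hq.trans h2, Set.disjoint_left.2 fun x hx hxK => ?_⟩
  · by_contra hcon
    exact Set.disjoint_left.1 hW.1 (Or.inr (hq hz)) ⟨q, (not_le.1 hcon).le, hz.symm⟩
  · have := subset_of_connected_of_disjoint hC
      (fun u hu v hv => mem_border_of_adj hu hv) hW.2 ⟨x, h1 hx, hxK⟩ (Or.inr (hq hz))
    simp [hz, Level.Inner] at this

end Nodes

/-- If a set `K` contains the bag of `s`, is disjoint from the bag of `t`, and can only be left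
through a finite set `X`, then some adhesion set on the path from `s` to `t` has at most
`X.ncard` elements. -/
theorem TreeDecomp.StronglyLinked.exists_ncard_adh_le {V : Type u} {N : Type v}
    {G : SimpleGraph V} {T : SimpleGraph N} {D : TreeDecomp G T} (hD : D.StronglyLinked)
    {s t : N} (hst : s ≠ t) {K X : Set V} (hX : X.Finite)
    (hK : ∀ u ∈ K, ∀ v ∉ K, G.Adj u v → v ∈ X) (hs : D.bag s ⊆ K) (ht : Disjoint (D.bag t) K) :
    ∃ a b, D.EdgeOnPath s t a b ∧ (D.adh a b).ncard ≤ X.ncard := by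
  obtain ⟨c, -, ⟨a, b, hab, hc⟩, ι, hι, x, y, p, -, hx, hy, hp⟩ := hD s t hst
  refine ⟨a, b, hab, ?_⟩
  have hit : ∀ j, ∃ v ∈ (p j).support, v ∈ X := by
    intro j
    obtain ⟨d, hd, h1, h2⟩ := (p j).exists_boundary_dart K (hs (hx j))
      (Set.disjoint_left.1 ht (hy j))
    exact ⟨d.snd, Walk.dart_snd_mem_support_of_mem_darts _ hd, hK _ h1 _ h2 d.adj⟩
  choose f hfp hfX using hit
  have hinj : Function.Injective fun j => (⟨f j, hfX j⟩ : X) := by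
    intro j k h
    by_contra hne
    have h : f j = f k := congrArg Subtype.val h
    exact hp hne _ (hfp j) (h ▸ hfp k)
  have : Finite X := hX
  calc (D.adh a b).ncard = Nat.card ι := congrArg Cardinal.toNat (hc.symm.trans hι.symm)
    _ ≤ X.ncard := Nat.card_le_card_of_injective _ hinj

/-- There exists an infinite, locally finite, connected graph that admits no
rooted tree-decomposition into finite parts which is simultaneously strongly linked, tight
and componental. -/
theorem statement_4 :
    ∃ G : SimpleGraph ℕ, LocFin G ∧ G.Connected ∧
      ∀ (M : Type v) (T : SimpleGraph M) (D : RootedTreeDecomp G T),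
        D.toTreeDecomp.FiniteParts →
          ¬ (D.toTreeDecomp.StronglyLinked ∧ D.Tight ∧ D.Componental) := by
  obtain ⟨π, hπ⟩ := exists_hasLevelSizes
  refine ⟨levelGraph π, hπ.locFin, hπ.connected, ?_⟩
  rintro M T D hfin ⟨hlink, ht, hc⟩
  obtain ⟨f, hf⟩ := hπ.exists_eq (.F 0)
  obtain ⟨i, hi⟩ := ht.exists_ncard_adh_le hπ.locFin hfin f
  obtain ⟨s, p, hps, hsK⟩ := exists_inner_bag hπ ht hc hfin i
  obtain ⟨t, q, hq, hqt, htK⟩ := exists_outer_bag hπ ht hc hfin i (2 * i + 3)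
  have hst : s ≠ t := by
    rintro rfl
    obtain ⟨z, hz⟩ := hπ.exists_eq (.L i p)
    exact Set.disjoint_left.1 htK (hps hz) (hsK (hps hz))
  obtain ⟨a, b, hab, hle⟩ := hlink.exists_ncard_adh_le hst
    (hπ.finite_preimage (Finset.finite_toSet (Level.border i)))
    (fun u hu v hv => mem_border_of_adj hu hv) hsK htK
  rw [hπ.ncard_preimage, Level.sum_weight_border] at hle
  obtain ⟨h1, h2⟩ := hπ.preimage_F_zero_subset ((hfin a).subset Set.inter_subset_left) hle hq
    fun x y hx hy => D.toTreeDecomp.not_connAvoiding_adh hab (hps hx) (hqt hy)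
  exact absurd (h2.trans (hi a b (h1 hf))) (by omega)
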